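/- Let M be a positive integer. For every δ > 0, the Hausdorff dimension of B_2 ∩ (q', q'+δ) is strictly positive, where q' = q'(M) is the Komornik-Loreti constant. -/

import Mathlib

open Set MeasureTheory Filter

noncomputable section

/-- The projection `π_q` of a digit sequence (0-indexed): `∑ d i / q^(i+1)`. -/
def piQ (q : ℝ) (d : ℕ → ℕ) : ℝ := ∑' i : ℕ, (d i : ℝ) / q ^ (i + 1)

/-- `d` is a `q`-expansion of `x` over the alphabet `{0,…,M}`. -/
def IsExpansion (M : ℕ) (q x : ℝ) (d : ℕ → ℕ) : Prop :=
  (∀ i, d i ≤ M) ∧ piQ q d = x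

/-- `U'_q`: digit sequences that are the unique `q`-expansion of their projection. -/
def UnivSeqs (M : ℕ) (q : ℝ) : Set (ℕ → ℕ) :=
  {d | (∀ i, d i ≤ M) ∧ ∀ e : ℕ → ℕ, IsExpansion M q (piQ q d) e → e = d}

/-- The set `U = U(M)` of univoque bases: `q ∈ (1, M+1]` such that `1` has a
unique `q`-expansion over `{0,…,M}`. -/
def UnivBases (M : ℕ) : Set ℝ :=
  {q | 1 < q ∧ q ≤ M + 1 ∧ ∃! d : ℕ → ℕ, IsExpansion M q 1 d}

/-- The Komornik–Loreti constant `q'(M) = min U(M)`. -/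
def KL (M : ℕ) : ℝ := sInf (UnivBases M)

/-- `(a, b)` is a connected component of `(q'(M), M+1) \ closure (U(M))`:
an open subinterval whose endpoints do not lie in that (open) set. -/
def CC (M : ℕ) (a b : ℝ) : Prop :=
  a < b ∧ Ioo a b ⊆ Ioo (KL M) (M + 1) \ closure (UnivBases M) ∧
    a ∉ Ioo (KL M) (M + 1) \ closure (UnivBases M) ∧
    b ∉ Ioo (KL M) (M + 1) \ closure (UnivBases M)

/-- `x ∈ [0, M/(q-1)]` has exactly two distinct `q`-expansions. -/
def HasExactlyTwoExpansions (M : ℕ) (q x : ℝ) : Prop :=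
  ∃ c d : ℕ → ℕ, c ≠ d ∧ IsExpansion M q x c ∧ IsExpansion M q x d ∧
    ∀ e : ℕ → ℕ, IsExpansion M q x e → e = c ∨ e = d

/-- `B_2(M)`: bases `q ∈ (1, M+1]` for which some `x ∈ [0, M/(q-1)]` has exactly
two `q`-expansions. -/
def B2 (M : ℕ) : Set ℝ :=
  {q | 1 < q ∧ q ≤ M + 1 ∧
    ∃ x ∈ Icc (0 : ℝ) (M / (q - 1)), HasExactlyTwoExpansions M q x}

/-- Strict lexicographic order on digit sequences. -/
def seqLt (a b : ℕ → ℕ) : Prop := ∃ n, (∀ i < n, a i = b i) ∧ a n < b n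

/-- Lexicographic order on digit sequences. -/
def seqLe (a b : ℕ → ℕ) : Prop := seqLt a b ∨ a = b

/-- A digit sequence is infinite if it does not end with `0^∞` after a last
nonzero digit (in particular `0^∞` is infinite). -/
def IsInfiniteSeq (a : ℕ → ℕ) : Prop := ¬∃ m, a m ≠ 0 ∧ ∀ i > m, a i = 0

/-- `a = α(q)`, the quasi-greedy `q`-expansion of `1`: the lexicographically
largest infinite `q`-expansion of `1`. -/
def IsQuasiGreedy (M : ℕ) (q : ℝ) (a : ℕ → ℕ) : Prop :=
  IsExpansion M q 1 a ∧ IsInfiniteSeq a ∧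
    ∀ b : ℕ → ℕ, IsExpansion M q 1 b → IsInfiniteSeq b → seqLe b a

/-- `b = β(q)`, the greedy `q`-expansion of `1`: the lexicographically largest
`q`-expansion of `1`. -/
def IsGreedy (M : ℕ) (q : ℝ) (b : ℕ → ℕ) : Prop :=
  IsExpansion M q 1 b ∧ ∀ c : ℕ → ℕ, IsExpansion M q 1 c → seqLe c b

/-- `w⁺`: increase the last digit of a word by one. -/
def plusWord : List ℕ → List ℕ
  | [] => []
  | [a] => [a + 1]
  | a :: b :: rest => a :: plusWord (b :: rest)

/-- `w⁻`: decrease the last digit of a word by one. -/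
def minusWord : List ℕ → List ℕ
  | [] => []
  | [a] => [a - 1]
  | a :: b :: rest => a :: minusWord (b :: rest)

/-- The reflection of a word: `\overline{w} = (M - w_1) ⋯ (M - w_k)`. -/
def reflWord (M : ℕ) (w : List ℕ) : List ℕ := w.map fun a => M - a

/-- The substitution `g(w) = w⁺ \overline{w⁺}`. -/
def gWord (M : ℕ) (w : List ℕ) : List ℕ := plusWord w ++ reflWord M (plusWord w)

/-- The periodic sequence `t^∞` determined by a word `t`. -/
def periodicSeq (t : List ℕ) (i : ℕ) : ℕ := t.getD (i % t.length) 0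

/-- Strict lexicographic order on words. -/
def wordLt (u v : List ℕ) : Prop := List.Lex (· < ·) u v

/-- Lexicographic order on words. -/
def wordLe (u v : List ℕ) : Prop := wordLt u v ∨ u = v

/-- The connected component `(q_0, q_0^*)` of `(q'(M), M+1) \ closure (U(M))` is
generated by the word `t`, and `θ = α(q_0^*)`: `α(q_0) = t^∞` and
`α(q_0^*) = lim_{n→∞} g^n(t)`, i.e. every `g^n(t)` is a prefix of `θ`. -/
def GeneratedBy (M : ℕ) (q₀ q₀star : ℝ) (t : List ℕ) (θ : ℕ → ℕ) : Prop :=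
  CC M q₀ q₀star ∧ t ≠ [] ∧ IsQuasiGreedy M q₀ (periodicSeq t) ∧
    IsQuasiGreedy M q₀star θ ∧
    ∀ n : ℕ, ∀ i < ((gWord M)^[n] t).length, ((gWord M)^[n] t).getD i 0 = θ i


/-- The sequence obtained from `d` by dropping its first `n` digits. -/
def tailSeq (n : ℕ) (d : ℕ → ℕ) : ℕ → ℕ := fun i => d (i + n)

/-- The reflection `\overline{d}` of a digit sequence. -/
def reflSeq (M : ℕ) (d : ℕ → ℕ) : ℕ → ℕ := fun i => M - d i

lemma hasSum_const_div_pow {q : ℝ} (hq : 1 < q) (a : ℝ) :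
    HasSum (fun i : ℕ => a / q ^ (i + 1)) (a / (q - 1)) := by
  have h := (hasSum_geometric_of_lt_one (inv_nonneg.2 (by linarith : (0 : ℝ) ≤ q))
    (inv_lt_one_of_one_lt₀ hq)).mul_left (a / q)
  have h0 : q ≠ 0 := by linarith
  have h1 : q - 1 ≠ 0 := by linarith
  have hf : (fun i : ℕ => a / q ^ (i + 1)) = fun i => a / q * q⁻¹ ^ i := by
    ext i
    rw [inv_pow, pow_succ]
    field_simp
  have ha : a / (q - 1) = a / q * (1 - q⁻¹)⁻¹ := by
    have h2 : 1 - q⁻¹ = (q - 1) / q := by field_simp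
    rw [h2]
    field_simp
  rw [hf, ha]
  exact h

section Projection

variable {M : ℕ} {q : ℝ} {d : ℕ → ℕ}

lemma summable_piQ (hq : 1 < q) (hd : ∀ i, d i ≤ M) :
    Summable fun i : ℕ => (d i : ℝ) / q ^ (i + 1) := by
  refine Summable.of_nonneg_of_le (fun i => by positivity) (fun i => ?_)
    (hasSum_const_div_pow hq (M : ℝ)).summable
  have : (d i : ℝ) ≤ M := by exact_mod_cast hd i
  gcongr

lemma piQ_nonneg (hq : 1 < q) (d : ℕ → ℕ) : 0 ≤ piQ q d :=
  tsum_nonneg fun i => by positivity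

lemma piQ_le (hq : 1 < q) (hd : ∀ i, d i ≤ M) : piQ q d ≤ M / (q - 1) := by
  rw [← (hasSum_const_div_pow hq (M : ℝ)).tsum_eq]
  refine Summable.tsum_le_tsum (fun i => ?_) (summable_piQ hq hd)
    (hasSum_const_div_pow hq (M : ℝ)).summable
  have : (d i : ℝ) ≤ M := by exact_mod_cast hd i
  gcongr

lemma piQ_reflSeq (hq : 1 < q) (hd : ∀ i, d i ≤ M) :
    piQ q (reflSeq M d) = M / (q - 1) - piQ q d := by
  have h := (hasSum_const_div_pow hq (M : ℝ)).sub (summable_piQ hq hd).hasSum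
  rw [piQ, piQ, ← h.tsum_eq]
  congr 1
  ext i
  rw [reflSeq, Nat.cast_sub (hd i), sub_div]

lemma piQ_eq_head_add (hq : 1 < q) (hd : ∀ i, d i ≤ M) :
    piQ q d = (d 0 + piQ q (tailSeq 1 d)) / q := by
  rw [piQ, (summable_piQ hq hd).tsum_eq_zero_add, piQ, add_div, ← tsum_div_const]
  congr 1
  · simp
  · congr 1
    ext i
    rw [tailSeq, div_div, ← pow_succ]

lemma tailSeq_tailSeq (m n : ℕ) (d : ℕ → ℕ) : tailSeq m (tailSeq n d) = tailSeq (m + n) d := by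
  ext i
  simp only [tailSeq, add_assoc]

lemma tailSeq_zero (d : ℕ → ℕ) : tailSeq 0 d = d := rfl

lemma tailSeq_le (hd : ∀ i, d i ≤ M) (n i : ℕ) : tailSeq n d i ≤ M := hd _

lemma reflSeq_le (d : ℕ → ℕ) (i : ℕ) : reflSeq M d i ≤ M := Nat.sub_le _ _

lemma piQ_tailSeq (hq : 1 < q) (hd : ∀ i, d i ≤ M) (n : ℕ) :
    piQ q (tailSeq n d) = (d n + piQ q (tailSeq (n + 1) d)) / q := by
  rw [piQ_eq_head_add hq (tailSeq_le hd n), tailSeq_tailSeq, add_comm 1 n, tailSeq, zero_add]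

lemma piQ_sub_of_agree {e : ℕ → ℕ} (hq : 1 < q) (hd : ∀ i, d i ≤ M) (he : ∀ i, e i ≤ M) {k : ℕ}
    (h : ∀ i < k, d i = e i) :
    piQ q d - piQ q e = (piQ q (tailSeq k d) - piQ q (tailSeq k e)) / q ^ k := by
  induction k with
  | zero => simp [tailSeq_zero]
  | succ k ih =>
    rw [ih fun i hi => h i (by omega), piQ_tailSeq hq hd, piQ_tailSeq hq he, h k (by omega),
      pow_succ]
    have : q ≠ 0 := by linarith
    field_simp
    ring

/-- At the first position where two sequences differ, the difference of their projections is
determined by the two digits there and the two remaining tails. -/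
lemma piQ_sub_of_agree_succ {e : ℕ → ℕ} (hq : 1 < q) (hd : ∀ i, d i ≤ M) (he : ∀ i, e i ≤ M)
    {k : ℕ} (h : ∀ i < k, d i = e i) :
    piQ q d - piQ q e = ((d k : ℝ) - e k + piQ q (tailSeq (k + 1) d)
      - piQ q (tailSeq (k + 1) e)) / q ^ (k + 1) := by
  rw [piQ_sub_of_agree hq hd he h, piQ_tailSeq hq hd, piQ_tailSeq hq he, pow_succ]
  have : q ≠ 0 := by linarith
  field_simp
  ring

lemma exists_first_ne {d e : ℕ → ℕ} (h : d ≠ e) : ∃ k, (∀ i < k, d i = e i) ∧ d k ≠ e k := by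
  classical
  have hex := Function.ne_iff.1 h
  exact ⟨Nat.find hex, fun i hi => not_not.1 (Nat.find_min hex hi), Nat.find_spec hex⟩

lemma le_piQ (hq : 1 < q) (hd : ∀ i, d i ≤ M) (i : ℕ) : (d i : ℝ) / q ^ (i + 1) ≤ piQ q d :=
  (summable_piQ hq hd).le_tsum i fun j _ => by positivity

lemma piQ_pos (hq : 1 < q) (hd : ∀ i, d i ≤ M) {i : ℕ} (hi : d i ≠ 0) : 0 < piQ q d := by
  refine lt_of_lt_of_le ?_ (le_piQ hq hd i)
  have : (0 : ℝ) < d i := by exact_mod_cast Nat.pos_of_ne_zero hi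
  positivity

lemma eq_zero_of_piQ_eq_zero (hq : 1 < q) (hd : ∀ i, d i ≤ M) (h : piQ q d = 0) (i : ℕ) :
    d i = 0 := by
  by_contra hi
  exact (piQ_pos hq hd hi).ne' h

lemma le_of_piQ_eq_one (hq : 1 < q) (hd : ∀ i, d i ≤ M) (h : piQ q d = 1) : q ≤ M + 1 := by
  have := piQ_le hq hd
  rw [h, le_div_iff₀ (by linarith)] at this
  linarith

/-- The projection is Lipschitz in the base, uniformly in the digit sequence, on bases bounded
away from `1`. -/
lemma exists_lipschitz_piQ (M : ℕ) {a : ℝ} (ha : 1 < a) :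
    ∃ C : ℝ, 0 < C ∧ ∀ d : ℕ → ℕ, (∀ i, d i ≤ M) → ∀ q q' : ℝ, a ≤ q → a ≤ q' →
      |piQ q d - piQ q' d| ≤ C * |q - q'| := by
  have hr : ‖a⁻¹‖ < 1 := by
    rw [Real.norm_of_nonneg (by positivity)]
    exact inv_lt_one_of_one_lt₀ ha
  have hs : Summable fun i : ℕ => ((i + 1 : ℕ) : ℝ) * a⁻¹ ^ i := by
    have h1 := summable_pow_mul_geometric_of_norm_lt_one 1 hr
    have h2 := summable_geometric_of_norm_lt_one hr
    refine (h1.add h2).congr fun i => ?_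
    push_cast
    ring
  refine ⟨M * ∑' i : ℕ, ((i + 1 : ℕ) : ℝ) * a⁻¹ ^ i + 1, ?_, ?_⟩
  · have : 0 ≤ ∑' i : ℕ, ((i + 1 : ℕ) : ℝ) * a⁻¹ ^ i := tsum_nonneg fun i => by positivity
    positivity
  intro d hd q q' hq hq'
  have hq0 : 0 < q := by linarith
  have hq0' : 0 < q' := by linarith
  have hinv : |q⁻¹ - q'⁻¹| ≤ |q - q'| := by
    rw [inv_sub_inv hq0.ne' hq0'.ne', abs_div, abs_sub_comm q' q, abs_of_pos (mul_pos hq0 hq0')]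
    exact div_le_self (abs_nonneg _) (by nlinarith)
  have hterm : ∀ i, ‖(d i : ℝ) / q ^ (i + 1) - d i / q' ^ (i + 1)‖ ≤
      M * (((i + 1 : ℕ) : ℝ) * a⁻¹ ^ i) * |q - q'| := by
    intro i
    have h1 := abs_pow_sub_pow_le q⁻¹ q'⁻¹ (i + 1)
    have h2 : max |q⁻¹| |q'⁻¹| ≤ a⁻¹ := by
      rw [abs_of_pos (inv_pos.2 hq0), abs_of_pos (inv_pos.2 hq0')]
      exact max_le (inv_anti₀ (by linarith) hq) (inv_anti₀ (by linarith) hq')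
    have h3 : (d i : ℝ) ≤ M := by exact_mod_cast hd i
    rw [div_eq_mul_inv, div_eq_mul_inv, ← mul_sub, ← inv_pow, ← inv_pow, Real.norm_eq_abs, abs_mul,
      abs_of_nonneg (Nat.cast_nonneg _), mul_assoc]
    have h4 : |q⁻¹ ^ (i + 1) - q'⁻¹ ^ (i + 1)| ≤ |q - q'| * ((i + 1 : ℕ) : ℝ) * a⁻¹ ^ i := by
      refine h1.trans ?_
      rw [Nat.add_sub_cancel]
      gcongr
    calc (d i : ℝ) * |q⁻¹ ^ (i + 1) - q'⁻¹ ^ (i + 1)|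
        ≤ M * (|q - q'| * ((i + 1 : ℕ) : ℝ) * a⁻¹ ^ i) := by gcongr
      _ = _ := by ring
  have hsum := ((hs.mul_left (M : ℝ)).mul_right |q - q'|).hasSum
  have h := tsum_of_norm_bounded hsum hterm
  rw [Summable.tsum_sub (summable_piQ (by linarith) hd) (summable_piQ (by linarith) hd),
    tsum_mul_right, tsum_mul_left, Real.norm_eq_abs] at h
  refine h.trans ?_
  rw [add_mul, one_mul]
  linarith [abs_nonneg (q - q')]

/-- For `1 < q ≤ M + 1`, every point of `[0, M/(q-1)]` has a `q`-expansion. -/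
lemma exists_isExpansion (hq : 1 < q) (hqM : q ≤ M + 1) {y : ℝ} (hy : y ∈ Icc 0 (M / (q - 1))) :
    ∃ d, IsExpansion M q y d := by
  have hq0 : 0 < q := by linarith
  have hq1 : 0 < q - 1 := by linarith
  have hstep : ∀ r : Icc (0 : ℝ) (M / (q - 1)), ∃ c : ℕ, c ≤ M ∧
      q * r - c ∈ Icc (0 : ℝ) (M / (q - 1)) := by
    rintro ⟨r, hr0, hr1⟩
    have hnn : 0 ≤ q * r := by positivity
    rcases le_or_gt ⌊q * r⌋₊ M with h | h
    · refine ⟨_, h, sub_nonneg.2 (Nat.floor_le hnn), ?_⟩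
      have h1 : 1 ≤ (M : ℝ) / (q - 1) := by
        rw [le_div_iff₀ hq1]
        linarith
      have := Nat.lt_floor_add_one (q * r)
      simp only
      linarith
    · refine ⟨M, le_rfl, ?_, ?_⟩
      · have h1 : (M : ℝ) ≤ ⌊q * r⌋₊ := by exact_mod_cast h.le
        simp only
        linarith [Nat.floor_le hnn]
      · simp only
        rw [le_div_iff₀ hq1] at hr1 ⊢
        nlinarith
  choose c hcM hc using hstep
  let r : ℕ → Icc (0 : ℝ) (M / (q - 1)) := fun n =>
    Nat.rec ⟨y, hy⟩ (fun _ s => ⟨q * s - c s, hc s⟩) n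
  have hr : ∀ n, (r (n + 1)).1 = q * (r n).1 - c (r n) := by
    intro n
    rfl
  refine ⟨fun n => c (r n), fun n => hcM _, ?_⟩
  have hpart : ∀ n, ∑ i ∈ Finset.range n, (c (r i) : ℝ) / q ^ (i + 1) = y - (r n).1 / q ^ n := by
    intro n
    induction n with
    | zero =>
      have : (r 0).1 = y := rfl
      simp [this]
    | succ n ih =>
      rw [Finset.sum_range_succ, ih, hr, pow_succ]
      field_simp
      ring
  refine HasSum.tsum_eq ?_
  rw [(summable_piQ hq fun n => hcM (r n)).hasSum_iff_tendsto_nat]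
  simp_rw [hpart]
  have hlim : Tendsto (fun n => (r n).1 / q ^ n) atTop (nhds 0) := by
    have h1 : Tendsto (fun n : ℕ => (M / (q - 1)) * (q⁻¹) ^ n) atTop (nhds 0) := by
      simpa using (tendsto_pow_atTop_nhds_zero_of_lt_one (inv_nonneg.2 hq0.le)
        (inv_lt_one_of_one_lt₀ hq)).const_mul ((M : ℝ) / (q - 1))
    refine squeeze_zero (fun n => div_nonneg (r n).2.1 (by positivity)) (fun n => ?_) h1
    rw [inv_pow, ← div_eq_mul_inv]
    gcongr
    exact (r n).2.2
  simpa using hlim.const_sub y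

end Projection

section Univoque

variable {M : ℕ} {q : ℝ}

lemma tailSeq_reflSeq_tailSeq (m n : ℕ) (d : ℕ → ℕ) :
    tailSeq m (reflSeq M (tailSeq n d)) = reflSeq M (tailSeq (m + n) d) := by
  rw [← tailSeq_tailSeq]
  rfl

lemma tailSeq_mem {X : Set (ℕ → ℕ)} (hX : ∀ x ∈ X, tailSeq 1 x ∈ X) {x : ℕ → ℕ} (hx : x ∈ X)
    (n : ℕ) : tailSeq n x ∈ X := by
  induction n with
  | zero => exact hx
  | succ n ih =>
    rw [add_comm, ← tailSeq_tailSeq]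
    exact hX _ ih

/-- If `x` is lexicographically smaller than `β`, the difference of their projections is controlled
by the tails after the first position where they differ. -/
lemma piQ_sub_le_of_seqLt {x β : ℕ → ℕ} (hq : 1 < q) (hx : ∀ i, x i ≤ M) (hβ : ∀ i, β i ≤ M)
    (h : seqLt x β) : ∃ k, piQ q x - piQ q β ≤
      (piQ q (tailSeq (k + 1) x) - 1 - piQ q (tailSeq (k + 1) β)) / q ^ (k + 1) := by
  obtain ⟨k, hk, hlt⟩ := h
  refine ⟨k, ?_⟩
  rw [piQ_sub_of_agree_succ hq hx hβ hk]
  have : (x k : ℝ) + 1 ≤ β k := by exact_mod_cast hlt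
  gcongr
  linarith

lemma piQ_le_one_of_seqLe {X : Set (ℕ → ℕ)} {β : ℕ → ℕ} (hq : 1 < q)
    (hXM : ∀ x ∈ X, ∀ i, x i ≤ M) (hX : ∀ x ∈ X, tailSeq 1 x ∈ X) (hβX : β ∈ X)
    (hβ : piQ q β = 1) (hle : ∀ x ∈ X, seqLe x β) : ∀ x ∈ X, piQ q x ≤ 1 := by
  have hbdd : BddAbove (piQ q '' X) := by
    refine ⟨M / (q - 1), ?_⟩
    rintro _ ⟨x, hx, rfl⟩
    exact piQ_le hq (hXM x hx)
  set S := sSup (piQ q '' X) with hS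
  have hxS : ∀ x ∈ X, piQ q x ≤ S := fun x hx => le_csSup hbdd ⟨x, hx, rfl⟩
  have hS1 : 1 ≤ S := hβ ▸ hxS β hβX
  have hstep : ∀ x ∈ X, piQ q x ≤ 1 + (S - 1) / q := by
    intro x hx
    rcases hle x hx with h | rfl
    · obtain ⟨k, hk⟩ := piQ_sub_le_of_seqLt hq (hXM x hx) (hXM β hβX) h
      have h1 := hxS _ (tailSeq_mem hX hx (k + 1))
      have h2 := piQ_nonneg hq (tailSeq (k + 1) β)
      have h3 : (piQ q (tailSeq (k + 1) x) - 1 - piQ q (tailSeq (k + 1) β)) / q ^ (k + 1) ≤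
          (S - 1) / q := by
        refine (div_le_div_of_nonneg_right (by linarith : _ ≤ S - 1) (by positivity)).trans ?_
        refine div_le_div_of_nonneg_left (by linarith) (by linarith) ?_
        exact le_self_pow₀ hq.le (by omega)
      linarith
    · rw [hβ]
      have : 0 ≤ (S - 1) / q := div_nonneg (by linarith) (by linarith)
      linarith
  have hSle : S ≤ 1 + (S - 1) / q := by
    refine csSup_le ⟨_, β, hβX, rfl⟩ ?_
    rintro _ ⟨x, hx, rfl⟩
    exact hstep x hx
  have hS2 : S ≤ 1 := by
    have hq0 : 0 < q := by linarith
    have h1 : (S - 1) * q ≤ S - 1 := by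
      rw [← le_div_iff₀ hq0]
      linarith
    nlinarith
  exact fun x hx => (hxS x hx).trans hS2

/-- The lexicographic conditions on a digit sequence that characterize quasi-greedy expansions of
`1` in univoque bases. -/
structure IsStrictlyAdmissible (M : ℕ) (β : ℕ → ℕ) : Prop where
  le : ∀ i, β i ≤ M
  tail_lt : ∀ n, 0 < n → seqLt (tailSeq n β) β
  refl_tail_lt : ∀ n, seqLt (reflSeq M (tailSeq n β)) β

namespace IsStrictlyAdmissible

variable {β : ℕ → ℕ}

lemma piQ_le_one (h : IsStrictlyAdmissible M β) (hq : 1 < q) (hβ : piQ q β = 1) (n : ℕ) :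
    piQ q (tailSeq n β) ≤ 1 ∧ piQ q (reflSeq M (tailSeq n β)) ≤ 1 := by
  let X : Set (ℕ → ℕ) := {x | ∃ n, x = tailSeq n β ∨ x = reflSeq M (tailSeq n β)}
  have key : ∀ x ∈ X, piQ q x ≤ 1 := by
    refine piQ_le_one_of_seqLe (M := M) hq ?_ ?_ ⟨0, Or.inl rfl⟩ hβ ?_
    · rintro x ⟨n, rfl | rfl⟩ i
      · exact h.le _
      · exact reflSeq_le _ i
    · rintro x ⟨n, rfl | rfl⟩
      · exact ⟨1 + n, Or.inl (tailSeq_tailSeq _ _ _)⟩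
      · exact ⟨1 + n, Or.inr (tailSeq_reflSeq_tailSeq _ _ _)⟩
    · rintro x ⟨n, rfl | rfl⟩
      · rcases Nat.eq_zero_or_pos n with rfl | hn
        · exact Or.inr rfl
        · exact Or.inl (h.tail_lt n hn)
      · exact Or.inl (h.refl_tail_lt n)
  exact ⟨key _ ⟨n, Or.inl rfl⟩, key _ ⟨n, Or.inr rfl⟩⟩

lemma piQ_tailSeq_pos (h : IsStrictlyAdmissible M β) (hq : 1 < q) (n : ℕ) :
    0 < piQ q (tailSeq n β) := by
  refine lt_of_le_of_ne (piQ_nonneg hq _) fun h0 => ?_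
  obtain ⟨k, -, hk⟩ := h.refl_tail_lt n
  have h1 := eq_zero_of_piQ_eq_zero hq (tailSeq_le h.le n) h0.symm k
  have h2 := h.le k
  rw [reflSeq, h1] at hk
  omega

lemma piQ_lt_one_of_seqLt (h : IsStrictlyAdmissible M β) (hq : 1 < q) (hβ : piQ q β = 1)
    {x : ℕ → ℕ} (hx : ∀ i, x i ≤ M) (hxt : ∀ n, piQ q (tailSeq n x) ≤ 1) (hlt : seqLt x β) :
    piQ q x < 1 := by
  obtain ⟨k, hk⟩ := piQ_sub_le_of_seqLt hq hx h.le hlt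
  have h1 := hxt (k + 1)
  have h2 := h.piQ_tailSeq_pos hq (k + 1)
  have h3 : (piQ q (tailSeq (k + 1) x) - 1 - piQ q (tailSeq (k + 1) β)) / q ^ (k + 1) < 0 :=
    div_neg_of_neg_of_pos (by linarith) (by positivity)
  linarith

lemma piQ_tailSeq_lt_one (h : IsStrictlyAdmissible M β) (hq : 1 < q) (hβ : piQ q β = 1) {n : ℕ}
    (hn : 0 < n) : piQ q (tailSeq n β) < 1 := by
  refine h.piQ_lt_one_of_seqLt hq hβ (tailSeq_le h.le n) (fun m => ?_) (h.tail_lt n hn)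
  rw [tailSeq_tailSeq]
  exact (h.piQ_le_one hq hβ _).1

lemma piQ_reflSeq_lt_one (h : IsStrictlyAdmissible M β) (hq : 1 < q) (hβ : piQ q β = 1) (n : ℕ) :
    piQ q (reflSeq M (tailSeq n β)) < 1 := by
  refine h.piQ_lt_one_of_seqLt hq hβ (reflSeq_le _) (fun m => ?_) (h.refl_tail_lt n)
  rw [tailSeq_reflSeq_tailSeq]
  exact (h.piQ_le_one hq hβ _).2

/-- A base in which a strictly admissible sequence represents `1` is univoque. -/
lemma mem_univBases (h : IsStrictlyAdmissible M β) (hq : 1 < q) (hβ : piQ q β = 1) :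
    q ∈ UnivBases M := by
  refine ⟨hq, le_of_piQ_eq_one hq h.le hβ, β, ⟨h.le, hβ⟩, ?_⟩
  rintro e ⟨heM, he⟩
  by_contra hne
  obtain ⟨k, hk, hkne⟩ := exists_first_ne hne
  have h0 := piQ_sub_of_agree_succ hq heM h.le hk
  rw [he, hβ, sub_self, eq_comm, div_eq_zero_iff] at h0
  have h1 : (e k : ℝ) - β k + piQ q (tailSeq (k + 1) e) - piQ q (tailSeq (k + 1) β) = 0 :=
    h0.resolve_right (by positivity)
  rcases lt_or_gt_of_ne hkne with hlt | hlt
  · have h2 : (e k : ℝ) + 1 ≤ β k := by exact_mod_cast hlt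
    have h3 := h.piQ_reflSeq_lt_one hq hβ (k + 1)
    rw [piQ_reflSeq hq (tailSeq_le h.le _)] at h3
    have h4 := piQ_le hq (tailSeq_le heM (k + 1))
    linarith
  · have h2 : (β k : ℝ) + 1 ≤ e k := by exact_mod_cast hlt
    have h3 := h.piQ_tailSeq_lt_one hq hβ (Nat.succ_pos k)
    have h4 := piQ_nonneg hq (tailSeq (k + 1) e)
    linarith

end IsStrictlyAdmissible

/-- If the digit at `n` may be changed to `c` and the tail after it
compensated within `[0, M/(q-1)]`, then `d` is not a unique expansion. -/
lemma exists_isExpansion_ne {x : ℝ} {d : ℕ → ℕ} (hq : 1 < q) (hqM : q ≤ M + 1)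
    (hd : IsExpansion M q x d) {n c : ℕ} (hc : c ≤ M) (hcn : c ≠ d n)
    (h : (d n : ℝ) - c + piQ q (tailSeq (n + 1) d) ∈ Icc (0 : ℝ) (M / (q - 1))) :
    ∃ e, IsExpansion M q x e ∧ e ≠ d := by
  obtain ⟨t, htM, ht⟩ := exists_isExpansion hq hqM h
  let e : ℕ → ℕ := fun i => if i < n then d i else if i = n then c else t (i - (n + 1))
  have heM : ∀ i, e i ≤ M := by
    intro i
    simp only [e]
    split_ifs
    exacts [hd.1 i, hc, htM _]
  have hen : e n = c := by simp [e]
  have het : tailSeq (n + 1) e = t := by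
    ext i
    have h1 : ¬ i + (n + 1) < n := by omega
    have h2 : ¬ i + (n + 1) = n := by omega
    simp only [tailSeq, e, if_neg h1, if_neg h2, Nat.add_sub_cancel]
  refine ⟨e, ⟨heM, ?_⟩, fun he => hcn (by rw [← hen, he])⟩
  have hk : ∀ i < n, e i = d i := fun i hi => by simp [e, hi]
  have h0 := piQ_sub_of_agree_succ hq heM hd.1 hk
  rw [hen, het, ht] at h0
  rw [← hd.2]
  have h1 : (c : ℝ) - d n + (d n - c + piQ q (tailSeq (n + 1) d)) -
      piQ q (tailSeq (n + 1) d) = 0 := by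
    ring
  rw [h1, zero_div] at h0
  linarith

section Unique

variable {α : ℕ → ℕ}

lemma piQ_tailSeq_lt_one_of_unique (hq : 1 < q) (hqM : q ≤ M + 1) (hα : IsExpansion M q 1 α)
    (huniq : ∀ e, IsExpansion M q 1 e → e = α) {n : ℕ} (hn : α n < M) :
    piQ q (tailSeq (n + 1) α) < 1 := by
  by_contra! hge
  have hle := piQ_le hq (tailSeq_le hα.1 (n + 1))
  obtain ⟨e, he, hne⟩ := exists_isExpansion_ne (c := α n + 1) (n := n) hq hqM hα hn (by omega)
    (by push_cast; constructor <;> linarith)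
  exact hne (huniq e he)

lemma piQ_reflSeq_lt_one_of_unique (hq : 1 < q) (hqM : q ≤ M + 1) (hα : IsExpansion M q 1 α)
    (huniq : ∀ e, IsExpansion M q 1 e → e = α) {n : ℕ} (hn : 0 < α n) :
    piQ q (reflSeq M (tailSeq (n + 1) α)) < 1 := by
  by_contra! hge
  rw [piQ_reflSeq hq (tailSeq_le hα.1 _)] at hge
  have hnn := piQ_nonneg hq (tailSeq (n + 1) α)
  have hnM := hα.1 n
  obtain ⟨e, he, hne⟩ := exists_isExpansion_ne (c := α n - 1) (n := n) hq hqM hα (by omega)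
    (by omega) (by rw [Nat.cast_sub hn]; push_cast; constructor <;> linarith)
  exact hne (huniq e he)

/-- A digit sequence whose value is at most one cannot exceed lexicographically a sequence of
value one that is a unique expansion. -/
lemma not_seqLt_of_unique (hq : 1 < q) (hqM : q ≤ M + 1) (hα : IsExpansion M q 1 α)
    (huniq : ∀ e, IsExpansion M q 1 e → e = α) {x : ℕ → ℕ} (hx : ∀ i, x i ≤ M)
    (h1 : piQ q x ≤ 1) : ¬ seqLt α x := by
  rintro ⟨k, hk, hlt⟩
  have h0 := piQ_sub_of_agree_succ hq hα.1 hx hk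
  have h2 : (α k : ℝ) + 1 ≤ x k := by exact_mod_cast hlt
  have h3 := piQ_tailSeq_lt_one_of_unique hq hqM hα huniq (hlt.trans_le (hx k))
  have h4 := piQ_nonneg hq (tailSeq (k + 1) x)
  have h5 : ((α k : ℝ) - x k + piQ q (tailSeq (k + 1) α) - piQ q (tailSeq (k + 1) x)) /
      q ^ (k + 1) < 0 := div_neg_of_neg_of_pos (by linarith) (by positivity)
  rw [← h0, hα.2] at h5
  linarith

lemma head_pos_of_unique (hM : 0 < M) (hq : 1 < q) (hqM : q ≤ M + 1) (hα : IsExpansion M q 1 α)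
    (huniq : ∀ e, IsExpansion M q 1 e → e = α) : 0 < α 0 := by
  by_contra! h0
  have h1 := piQ_tailSeq_lt_one_of_unique hq hqM hα huniq (n := 0) (by omega)
  have h2 := piQ_eq_head_add hq hα.1
  rw [hα.2, Nat.le_zero.1 h0, eq_div_iff (by linarith)] at h2
  simp only [zero_add, Nat.cast_zero] at h1 h2
  linarith

/-- The first digit of the unique expansion of `1` exceeds its reflection. -/
lemma reflSeq_head_lt_of_unique (hM : 0 < M) (hq : 1 < q) (hqM : q ≤ M + 1)
    (hα : IsExpansion M q 1 α) (huniq : ∀ e, IsExpansion M q 1 e → e = α) :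
    reflSeq M (tailSeq 0 α) 0 < α 0 := by
  have h0 := head_pos_of_unique hM hq hqM hα huniq
  simp only [reflSeq, tailSeq, add_zero]
  rcases (hα.1 0).lt_or_eq with h | h
  · have h1 := piQ_tailSeq_lt_one_of_unique hq hqM hα huniq h
    have h2 := piQ_eq_head_add hq hα.1
    have h3 := piQ_reflSeq_lt_one_of_unique hq hqM hα huniq h0
    rw [piQ_reflSeq hq (tailSeq_le hα.1 _)] at h3
    rw [hα.2, eq_div_iff (by linarith)] at h2
    simp only [zero_add] at h1 h3
    have h4 : (M : ℝ) / (q - 1) < 2 := by linarith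
    rw [div_lt_iff₀ (by linarith)] at h4
    have h5 : (M : ℝ) < 2 * α 0 := by linarith
    have h6 : M < 2 * α 0 := by exact_mod_cast h5
    omega
  · omega

/-- Tails of the unique expansion of `1` do not exceed it lexicographically. -/
lemma not_seqLt_tailSeq_of_unique (hq : 1 < q) (hqM : q ≤ M + 1) (hα : IsExpansion M q 1 α)
    (huniq : ∀ e, IsExpansion M q 1 e → e = α) (n : ℕ) : ¬ seqLt α (tailSeq n α) := by
  refine not_seqLt_of_unique hq hqM hα huniq (tailSeq_le hα.1 n) ?_
  induction n with
  | zero => exact hα.2.le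
  | succ n ih =>
    rcases (hα.1 n).lt_or_eq with hn | hn
    · exact (piQ_tailSeq_lt_one_of_unique hq hqM hα huniq hn).le
    · rw [piQ_tailSeq hq hα.1, hn, div_le_one (by linarith)] at ih
      linarith

/-- Reflected tails of the unique expansion of `1` are lexicographically smaller than it. -/
lemma seqLt_reflSeq_of_unique (hM : 0 < M) (hq : 1 < q) (hqM : q ≤ M + 1)
    (hα : IsExpansion M q 1 α) (huniq : ∀ e, IsExpansion M q 1 e → e = α) (n : ℕ) :
    seqLt (reflSeq M (tailSeq (n + 1) α)) α := by
  have hlt : piQ q (reflSeq M (tailSeq (n + 1) α)) < 1 := by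
    induction n with
    | zero =>
      exact piQ_reflSeq_lt_one_of_unique hq hqM hα huniq (head_pos_of_unique hM hq hqM hα huniq)
    | succ n ih =>
      rcases Nat.eq_zero_or_pos (α (n + 1)) with hn | hn
      · rw [piQ_eq_head_add hq (reflSeq_le _), div_lt_one (by linarith)] at ih
        have h1 : reflSeq M (tailSeq (n + 1) α) 0 = M := by simp [reflSeq, tailSeq, hn]
        have h2 : tailSeq 1 (reflSeq M (tailSeq (n + 1) α)) =
            reflSeq M (tailSeq (n + 1 + 1) α) := by
          rw [tailSeq_reflSeq_tailSeq, add_comm 1]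
        rw [h1, h2] at ih
        linarith
      · exact piQ_reflSeq_lt_one_of_unique hq hqM hα huniq hn
  have hne : reflSeq M (tailSeq (n + 1) α) ≠ α := fun h => by
    rw [h, hα.2] at hlt
    exact hlt.false
  obtain ⟨k, hk, hkne⟩ := exists_first_ne hne
  rcases lt_or_gt_of_ne hkne with h | h
  · exact ⟨k, hk, h⟩
  · exact absurd ⟨k, fun i hi => (hk i hi).symm, h⟩
      (not_seqLt_of_unique hq hqM hα huniq (reflSeq_le _) hlt.le)

end Unique

/-- A univoque base `q` lies in `B₂`: the point `1/q` has exactly two expansions. -/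
lemma univBases_subset_B2 (hM : 0 < M) : UnivBases M ⊆ B2 M := by
  rintro q ⟨hq, hqM, α, hα, huniq⟩
  have hq0 : 0 < q := by linarith
  let c : ℕ → ℕ := fun i => if i = 0 then 1 else 0
  let d : ℕ → ℕ := fun i => if i = 0 then 0 else α (i - 1)
  have hcM : ∀ i, c i ≤ M := fun i => by simp only [c]; split_ifs <;> omega
  have hdM : ∀ i, d i ≤ M := fun i => by
    simp only [d]
    split_ifs
    exacts [hM.le, hα.1 _]
  have hzero : piQ q (fun _ => 0) = 0 := by simp [piQ]
  have hc : piQ q c = 1 / q := by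
    have h1 : tailSeq 1 c = fun _ => 0 := by ext i; simp [tailSeq, c]
    rw [piQ_eq_head_add hq hcM, h1, hzero]
    simp [c]
  have hd : piQ q d = 1 / q := by
    have h1 : tailSeq 1 d = α := by ext i; simp [tailSeq, d]
    rw [piQ_eq_head_add hq hdM, h1, hα.2]
    simp [d]
  refine ⟨hq, hqM, 1 / q, ?_, c, d, fun h => ?_, ⟨hcM, hc⟩, ⟨hdM, hd⟩, ?_⟩
  · exact ⟨by positivity, hc ▸ piQ_le hq hcM⟩
  · have := congrFun h 0
    simp [c, d] at this
  rintro e ⟨heM, he⟩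
  rw [piQ_eq_head_add hq heM, div_left_inj' hq0.ne'] at he
  have hnn := piQ_nonneg hq (tailSeq 1 e)
  have he0 : e 0 ≤ 1 := by
    have : (e 0 : ℝ) ≤ 1 := by linarith
    exact_mod_cast this
  have htail : ∀ i, i ≠ 0 → e i = tailSeq 1 e (i - 1) := fun i hi => by
    simp only [tailSeq]
    congr 1
    omega
  interval_cases h0 : e 0
  · right
    have h1 : tailSeq 1 e = α := huniq _ ⟨tailSeq_le heM 1, by simpa using he⟩
    ext i
    by_cases hi : i = 0
    · simp [d, hi, h0]
    · rw [htail i hi, h1]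
      simp [d, hi]
  · left
    have h1 : piQ q (tailSeq 1 e) = 0 := by simpa using he
    ext i
    by_cases hi : i = 0
    · simp [c, hi, h0]
    · rw [htail i hi, eq_zero_of_piQ_eq_zero hq (tailSeq_le heM 1) h1]
      simp [c, hi]

lemma univBases_nonempty (hM : 0 < M) : (UnivBases M).Nonempty := by
  have hM' : (0 : ℝ) < M := by exact_mod_cast hM
  have hq : (1 : ℝ) < M + 1 := by linarith
  have h1 : piQ (M + 1 : ℝ) (fun _ => M) = 1 := by
    rw [piQ, (hasSum_const_div_pow hq (M : ℝ)).tsum_eq]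
    rw [add_sub_cancel_right, div_self hM'.ne']
  refine ⟨M + 1, hq, le_rfl, fun _ => M, ⟨fun _ => le_rfl, h1⟩, ?_⟩
  rintro e ⟨heM, he⟩
  have h2 := piQ_reflSeq hq heM
  rw [he, add_sub_cancel_right, div_self hM'.ne', sub_self] at h2
  ext i
  have h3 := eq_zero_of_piQ_eq_zero hq (reflSeq_le e) h2 i
  have h4 := heM i
  rw [reflSeq] at h3
  omega

end Univoque

section Blocks

/-- `m` is a length at which the prefix `w = α₀ ⋯ α_{m-1}` strictly dominates, lexicographically,
the reflections of all its suffixes. -/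
def IsGoodLength (M : ℕ) (α : ℕ → ℕ) (m : ℕ) : Prop :=
  ∀ r < m, ∃ k < m - r, (∀ i < k, M - α (r + i) = α i) ∧ M - α (r + k) < α k

lemma exists_isGoodLength {M : ℕ} {α : ℕ → ℕ}
    (hle : ∀ n, ¬ seqLt α (tailSeq n α)) (hrefl : ∀ n, seqLt (reflSeq M (tailSeq n α)) α)
    (N : ℕ) : ∃ m ≥ N, IsGoodLength M α m := by
  classical
  choose k hk hlt using hrefl
  simp only [reflSeq, tailSeq] at hk hlt
  simp only [add_comm _ (_ : ℕ)] at hk hlt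
  obtain ⟨m₀, hm₀N, hm₀⟩ : ∃ m₀ ≥ N, ∀ r < N, k r < m₀ - r := by
    refine ⟨N + ∑ r ∈ Finset.range N, (k r + 1), Nat.le_add_right _ _, fun r hr => ?_⟩
    have := Finset.single_le_sum (f := fun r => k r + 1) (fun _ _ => Nat.zero_le _)
      (Finset.mem_range.2 hr)
    omega
  by_cases hgood : ∀ r < m₀, k r < m₀ - r
  · exact ⟨m₀, hm₀N, fun r hr => ⟨k r, hgood r hr, hk r, hlt r⟩⟩
  push Not at hgood
  have hspec := Nat.find_spec hgood
  set s := Nat.find hgood with hs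
  have hmin : ∀ r < s, k r < m₀ - r := by
    intro r hr
    have := Nat.find_min hgood hr
    push Not at this
    exact this (hr.trans hspec.1)
  refine ⟨s, ?_, fun r hr => ⟨k r, ?_, hk r, hlt r⟩⟩
  · by_contra! hsN
    exact absurd (hm₀ s hsN) (by omega)
  by_contra! hkr
  obtain ⟨l, hl⟩ := Nat.exists_eq_add_of_le hkr
  have hkr' := hmin r hr
  refine hle (s - r) ⟨l, fun i hi => ?_, ?_⟩
  · have h1 := hk r (s - r + i) (by omega)
    have h2 := hk s i (by omega)
    have h3 : r + (s - r + i) = s + i := by omega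
    rw [h3] at h1
    rw [tailSeq, ← h2, h1, add_comm]
  · have h1 := hlt r
    have h2 := hk s l (by omega)
    have h3 : r + (s - r + l) = s + l := by omega
    rw [hl, h3, h2] at h1
    rwa [tailSeq, add_comm]

/-- The digit at place `r` of the block coded by the letter `x`: for `w = α₀ ⋯ α_{m-1}`, the letters
`3, 2, 1, 0` code the blocks `w`, `w⁻`, `\overline{w⁻}`, `\overline{w}`. -/
def blockDigit (M m : ℕ) (α : ℕ → ℕ) (x r : ℕ) : ℕ :=
  if x = 3 then α r
  else if x = 2 then (if r + 1 = m then α r - 1 else α r)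
  else if x = 1 then M - (if r + 1 = m then α r - 1 else α r)
  else M - α r

/-- The digit sequence obtained by concatenating the blocks coded by `c`. -/
def blockSeq (M m : ℕ) (α : ℕ → ℕ) (c : ℕ → ℕ) : ℕ → ℕ :=
  fun i => blockDigit M m α (c (i / m)) (i % m)

/-- The transitions between block letters that are allowed in the construction. -/
def IsTransition (x y : ℕ) : Prop :=
  (x = 3 ∧ y ≤ 1) ∨ (x = 2 ∧ (y = 2 ∨ y = 3)) ∨ (x = 1 ∧ y ≤ 1) ∨ (x = 0 ∧ (y = 2 ∨ y = 3))

variable {M m : ℕ} {α c b : ℕ → ℕ}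

lemma blockSeq_add (j : ℕ) {r : ℕ} (hr : r < m) :
    blockSeq M m α c (m * j + r) = blockDigit M m α (c j) r := by
  have hm : 0 < m := by omega
  rw [blockSeq, Nat.mul_add_div hm, Nat.div_eq_of_lt hr, Nat.mul_add_mod, Nat.mod_eq_of_lt hr,
    add_zero]

lemma blockSeq_prefix (hc : c 0 = 3) {i : ℕ} (hi : i < m) : blockSeq M m α c i = α i := by
  have := blockSeq_add (M := M) (α := α) (c := c) 0 hi
  rw [mul_zero, zero_add] at this
  rw [this, hc]
  simp [blockDigit]

lemma tailSeq_blockSeq (hm : 0 < m) (j : ℕ) :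
    tailSeq (m * j) (blockSeq M m α c) = blockSeq M m α (tailSeq j c) := by
  ext i
  simp only [tailSeq, blockSeq]
  rw [add_comm i, Nat.mul_add_div hm, Nat.mul_add_mod, add_comm j]

lemma blockDigit_le (hα : ∀ i, α i ≤ M) (x r : ℕ) : blockDigit M m α x r ≤ M := by
  have := hα r
  unfold blockDigit
  split_ifs <;> omega

lemma reflSeq_blockSeq (hα : ∀ i, α i ≤ M) (hc : ∀ i, c i ≤ 3) :
    reflSeq M (blockSeq M m α c) = blockSeq M m α (fun i => 3 - c i) := by
  ext i
  have h1 := hα (i % m)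
  have h2 := hc (i / m)
  simp only [reflSeq, blockSeq]
  interval_cases c (i / m) <;> simp [blockDigit] <;> (try split_ifs) <;> omega

lemma IsGoodLength.lt_last (h : IsGoodLength M α m) (hm : 0 < m) : M - α (m - 1) < α 0 := by
  obtain ⟨k, hk, -, hlt⟩ := h (m - 1) (by omega)
  obtain rfl : k = 0 := by omega
  simpa using hlt

lemma head_ge (hle : ∀ n, ¬ seqLt α (tailSeq n α)) (n : ℕ) : α n ≤ α 0 := by
  by_contra! h
  exact hle n ⟨0, fun i hi => by omega, by simpa [tailSeq] using h⟩

lemma exists_blockDigit_lt (hgood : IsGoodLength M α m) (hα : ∀ i, α i ≤ M)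
    (hle : ∀ n, ¬ seqLt α (tailSeq n α)) (hm : 2 ≤ m) {x y : ℕ} (hxy : x < y) (hy : y ≤ 3) :
    ∃ r < m, (∀ i < r, blockDigit M m α x i = blockDigit M m α y i) ∧
      blockDigit M m α x r < blockDigit M m α y r := by
  have h1 := hgood.lt_last (by omega)
  have h2 := head_ge hle (m - 1)
  have h3 := hα 0
  have h4 := hα (m - 1)
  have h5 : m - 1 + 1 = m := by omega
  by_cases hcase : (x = 0 ∧ y = 1) ∨ (x = 2 ∧ y = 3)
  · refine ⟨m - 1, by omega, fun i hi => ?_, ?_⟩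
    · have h6 : ¬ i + 1 = m := by omega
      rcases hcase with ⟨rfl, rfl⟩ | ⟨rfl, rfl⟩ <;> simp [blockDigit, h6]
    · rcases hcase with ⟨rfl, rfl⟩ | ⟨rfl, rfl⟩ <;> simp [blockDigit, h5] <;> omega
  · refine ⟨0, by omega, fun i hi => by omega, ?_⟩
    have h6 : ¬ 1 = m := by omega
    interval_cases y <;> interval_cases x <;> simp [blockDigit, h6] at hcase ⊢ <;> omega

lemma seqLt_blockSeq (hgood : IsGoodLength M α m) (hα : ∀ i, α i ≤ M)
    (hle : ∀ n, ¬ seqLt α (tailSeq n α)) (hm : 2 ≤ m) (hb : ∀ i, b i ≤ 3) (h : seqLt c b) :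
    seqLt (blockSeq M m α c) (blockSeq M m α b) := by
  obtain ⟨k, hk, hlt⟩ := h
  obtain ⟨r, hr, heq, hrlt⟩ := exists_blockDigit_lt hgood hα hle hm hlt (hb k)
  refine ⟨m * k + r, fun i hi => ?_, ?_⟩
  · rcases lt_or_ge i (m * k) with h1 | h1
    · simp only [blockSeq]
      rw [hk _ (Nat.div_lt_of_lt_mul h1)]
    · obtain ⟨s, rfl⟩ := Nat.exists_eq_add_of_le h1
      rw [blockSeq_add k (by omega), blockSeq_add k (by omega)]
      exact heq s (by omega)
  · rwa [blockSeq_add k hr, blockSeq_add k hr]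

/-- Shifting a concatenation of blocks to a position inside its first block gives a sequence
smaller than any sequence starting with `w`. -/
lemma seqLt_tailSeq_blockSeq (hgood : IsGoodLength M α m) (hα : ∀ i, α i ≤ M)
    (hle : ∀ n, ¬ seqLt α (tailSeq n α)) {β : ℕ → ℕ} (hβ : ∀ i < m, β i = α i)
    (hc : IsTransition (c 0) (c 1)) {r : ℕ} (hr0 : 0 < r) (hrm : r < m) :
    seqLt (tailSeq r (blockSeq M m α c)) β := by
  have hfirst : ∀ i < m - r, tailSeq r (blockSeq M m α c) i = blockDigit M m α (c 0) (r + i) := by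
    intro i hi
    have := blockSeq_add (M := M) (α := α) (c := c) 0 (r := r + i) (m := m) (by omega)
    rw [mul_zero, zero_add] at this
    rw [tailSeq, add_comm, this]
  have hsecond : ∀ i < r, tailSeq r (blockSeq M m α c) (m - r + i) =
      blockDigit M m α (c 1) i := by
    intro i hi
    have := blockSeq_add (M := M) (α := α) (c := c) 1 (r := i) (m := m) (by omega)
    rw [mul_one] at this
    rw [tailSeq, ← this]
    congr 1
    omega
  have hlast := hgood.lt_last (by omega)
  -- it suffices to compare the rest of the first block, and to decide ties by a low second block
  have hfin : ∀ k < m - r, (∀ i < k, blockDigit M m α (c 0) (r + i) = α i) →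
      blockDigit M m α (c 0) (r + k) < α k → seqLt (tailSeq r (blockSeq M m α c)) β := by
    intro k hk heq hlt
    refine ⟨k, fun i hi => ?_, ?_⟩
    · rw [hfirst i (by omega), hβ i (by omega), heq i hi]
    · rwa [hfirst k hk, hβ k (by omega)]
  have htie : (∀ i < m - r, blockDigit M m α (c 0) (r + i) = α i) → c 1 ≤ 1 →
      seqLt (tailSeq r (blockSeq M m α c)) β := by
    intro heq hc1
    have hdig : ∀ i < r, blockDigit M m α (c 1) i = M - α i := by
      intro i hi
      have h1 : ¬ i + 1 = m := by omega
      interval_cases c 1 <;> simp [blockDigit, h1]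
    obtain ⟨k, hk, hkeq, hklt⟩ := hgood (m - r) (by omega)
    have hkr : k < r := by omega
    refine ⟨m - r + k, fun i hi => ?_, ?_⟩
    · rcases lt_or_ge i (m - r) with h1 | h1
      · rw [hfirst i h1, hβ i (by omega), heq i h1]
      · obtain ⟨s, rfl⟩ := Nat.exists_eq_add_of_le h1
        have h2 := hkeq s (by omega)
        have h3 := hα (m - r + s)
        rw [hsecond s (by omega), hβ _ (by omega), hdig s (by omega)]
        omega
    · have h3 := hα k
      rw [hsecond k hkr, hβ _ (by omega), hdig k hkr]
      omega
  obtain ⟨k, hk, hkeq, hklt⟩ := hgood r hrm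
  have hself : (∀ i < m - r, α (r + i) = α i) ∨
      ∃ k < m - r, (∀ i < k, α (r + i) = α i) ∧ α (r + k) < α k := by
    by_cases h : ∀ i < m - r, α (r + i) = α i
    · exact Or.inl h
    · right
      have hne : tailSeq r α ≠ α := by
        intro h1
        refine h fun i _ => ?_
        rw [add_comm]
        exact congrFun h1 i
      obtain ⟨k, hk, hkne⟩ := exists_first_ne hne
      simp only [tailSeq, add_comm _ r] at hk hkne
      refine ⟨k, ?_, hk, ?_⟩
      · by_contra! h2
        exact h fun i hi => hk i (by omega)
      · refine lt_of_le_of_ne ?_ hkne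
        by_contra! h2
        exact hle r ⟨k, fun i hi => by rw [tailSeq, add_comm, hk i hi],
          by rwa [tailSeq, add_comm]⟩
  rcases hc with ⟨h0, h1⟩ | ⟨h0, h1⟩ | ⟨h0, h1⟩ | ⟨h0, h1⟩
  · have hd : ∀ i, blockDigit M m α (c 0) i = α i := fun i => by simp [blockDigit, h0]
    rcases hself with h | ⟨l, hl, hleq, hllt⟩
    · exact htie (fun i hi => by rw [hd, h i hi]) h1
    · exact hfin l hl (fun i hi => by rw [hd, hleq i hi]) (by rwa [hd])
  · have hd : ∀ i, i + 1 ≠ m → blockDigit M m α (c 0) i = α i := fun i hi => by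
      simp [blockDigit, h0, hi]
    have hd' : ∀ i, i + 1 = m → blockDigit M m α (c 0) i = α i - 1 := fun i hi => by
      simp [blockDigit, h0, hi]
    rcases hself with h | ⟨l, hl, hleq, hllt⟩
    · refine hfin (m - r - 1) (by omega) (fun i hi => ?_) ?_
      · rw [hd _ (by omega), h i (by omega)]
      · have h2 := h (m - r - 1) (by omega)
        have h3 : r + (m - r - 1) = m - 1 := by omega
        have h4 := hα 0
        have h5 := hα (m - 1)
        have h6 := head_ge hle (m - 1)
        rw [hd' _ (by omega), h2]
        rw [h3] at h2
        omega
    · refine hfin l hl (fun i hi => ?_) ?_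
      · rw [hd _ (by omega), hleq i hi]
      · by_cases h2 : r + l + 1 = m
        · rw [hd' _ h2]
          omega
        · rwa [hd _ h2]
  · have hd : ∀ i, i + 1 ≠ m → blockDigit M m α (c 0) i = M - α i := fun i hi => by
      simp [blockDigit, h0, hi]
    have hd' : ∀ i, i + 1 = m → blockDigit M m α (c 0) i = M - (α i - 1) := fun i hi => by
      simp [blockDigit, h0, hi]
    by_cases h2 : r + k + 1 = m
    · have h3 := hα (r + k)
      by_cases h4 : M - (α (r + k) - 1) = α k
      · refine htie (fun i hi => ?_) h1
        by_cases h5 : i = k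
        · rw [h5, hd' _ h2, h4]
        · rw [hd _ (by omega), hkeq i (by omega)]
      · refine hfin k hk (fun i hi => ?_) ?_
        · rw [hd _ (by omega), hkeq i hi]
        · rw [hd' _ h2]
          omega
    · refine hfin k hk (fun i hi => ?_) ?_
      · rw [hd _ (by omega), hkeq i hi]
      · rwa [hd _ h2]
  · have hd : ∀ i, blockDigit M m α (c 0) i = M - α i := fun i => by simp [blockDigit, h0]
    exact hfin k hk (fun i hi => by rw [hd, hkeq i hi]) (by rwa [hd])

/-- Conditions on a sequence of block letters under which the concatenation of the coded blocks is
strictly admissible. -/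
structure IsBlockCode (b : ℕ → ℕ) : Prop where
  le : ∀ j, b j ≤ 3
  transition : ∀ j, IsTransition (b j) (b (j + 1))
  zero : b 0 = 3
  one : b 1 = 1
  two : b 2 = 1
  after_three_one : ∀ j, 0 < j → b j = 3 → b (j + 1) = 1 → b (j + 2) = 0
  after_zero_two : ∀ j, b j = 0 → b (j + 1) = 2 → b (j + 2) = 3

lemma IsBlockCode.tail_lt (hb : IsBlockCode b) {j : ℕ} (hj : 0 < j) : seqLt (tailSeq j b) b := by
  have h0 := hb.zero
  have h1 := hb.one
  have h2 := hb.two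
  have hT := hb.transition j
  have hA := hb.after_three_one j hj
  have hle := hb.le j
  rw [IsTransition] at hT
  have e1 : tailSeq j b 1 = b (j + 1) := by rw [tailSeq, add_comm]
  have e2 : tailSeq j b 2 = b (j + 2) := by rw [tailSeq, add_comm]
  have e0 : tailSeq j b 0 = b j := by rw [tailSeq, zero_add]
  rcases hle.lt_or_eq with h | h
  · exact ⟨0, fun i hi => by omega, by omega⟩
  by_cases h3 : b (j + 1) = 0
  · exact ⟨1, fun i hi => by interval_cases i; omega, by omega⟩
  · have h4 := hA h (by omega)
    exact ⟨2, fun i hi => by interval_cases i <;> omega, by omega⟩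

lemma IsBlockCode.refl_tail_lt (hb : IsBlockCode b) (j : ℕ) :
    seqLt (fun i => 3 - tailSeq j b i) b := by
  have h0 := hb.zero
  have h1 := hb.one
  have h2 := hb.two
  have hT := hb.transition j
  have hA := hb.after_zero_two j
  rw [IsTransition] at hT
  have e1 : (fun i => 3 - tailSeq j b i) 1 = 3 - b (j + 1) := by simp only [tailSeq, add_comm]
  have e2 : (fun i => 3 - tailSeq j b i) 2 = 3 - b (j + 2) := by simp only [tailSeq, add_comm]
  have e0 : (fun i => 3 - tailSeq j b i) 0 = 3 - b j := by simp only [tailSeq, zero_add]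
  rcases Nat.eq_zero_or_pos (b j) with h | h
  · by_cases h3 : b (j + 1) = 3
    · exact ⟨1, fun i hi => by interval_cases i; omega, by omega⟩
    · have h4 := hA h (by omega)
      exact ⟨2, fun i hi => by interval_cases i <;> omega, by omega⟩
  · exact ⟨0, fun i hi => by omega, by omega⟩

lemma isStrictlyAdmissible_blockSeq (hgood : IsGoodLength M α m) (hα : ∀ i, α i ≤ M)
    (hle : ∀ n, ¬ seqLt α (tailSeq n α)) (hm : 2 ≤ m) (hb : IsBlockCode b) :
    IsStrictlyAdmissible M (blockSeq M m α b) := by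
  have hprefix : ∀ i < m, blockSeq M m α b i = α i := fun i hi => blockSeq_prefix hb.zero hi
  have hsplit : ∀ n, tailSeq n (blockSeq M m α b) =
      tailSeq (n % m) (blockSeq M m α (tailSeq (n / m) b)) := by
    intro n
    rw [← tailSeq_blockSeq (by omega), tailSeq_tailSeq, Nat.mod_add_div]
  refine ⟨fun i => blockDigit_le hα _ _, fun n hn => ?_, fun n => ?_⟩
  · rw [hsplit]
    rcases Nat.eq_zero_or_pos (n % m) with h | h
    · rw [h, tailSeq_zero]
      refine seqLt_blockSeq hgood hα hle hm hb.le (hb.tail_lt ?_)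
      exact Nat.div_pos (Nat.le_of_dvd hn (Nat.dvd_of_mod_eq_zero h)) (by omega)
    · refine seqLt_tailSeq_blockSeq hgood hα hle hprefix ?_ h (Nat.mod_lt _ (by omega))
      simp only [tailSeq, zero_add, add_comm 1]
      exact hb.transition _
  · have hrefl : reflSeq M (tailSeq n (blockSeq M m α b)) =
        tailSeq (n % m) (blockSeq M m α fun i => 3 - tailSeq (n / m) b i) := by
      rw [hsplit, ← reflSeq_blockSeq (c := tailSeq (n / m) b) hα fun i => hb.le _]
      rfl
    rw [hrefl]
    rcases Nat.eq_zero_or_pos (n % m) with h | h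
    · rw [h, tailSeq_zero]
      exact seqLt_blockSeq hgood hα hle hm hb.le (hb.refl_tail_lt _)
    · refine seqLt_tailSeq_blockSeq hgood hα hle hprefix ?_ h (Nat.mod_lt _ (by omega))
      have := hb.transition (n / m)
      simp only [tailSeq, zero_add, add_comm 1]
      rw [IsTransition] at this ⊢
      omega

/-- The block letters `3110` followed, for each digit of `ε`, by `310` or `302`. -/
def blockCode (ε : ℕ → ℕ) (j : ℕ) : ℕ :=
  if j = 0 then 3 else if j < 3 then 1 else if j = 3 then 0
  else if j % 3 = 1 then 3
  else if j % 3 = 2 then (if ε (j / 3 - 1) = 1 then 1 else 0)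
  else (if ε (j / 3 - 2) = 1 then 0 else 2)

lemma blockCode_add_four (ε : ℕ → ℕ) (n : ℕ) : blockCode ε (3 * n + 4) = 3 := by
  have h1 : (3 * n + 4) % 3 = 1 := by omega
  simp [blockCode, h1]

lemma blockCode_add_five (ε : ℕ → ℕ) (n : ℕ) :
    blockCode ε (3 * n + 5) = if ε n = 1 then 1 else 0 := by
  have h1 : (3 * n + 5) % 3 = 2 := by omega
  have h2 : (3 * n + 5) / 3 - 1 = n := by omega
  simp [blockCode, h1, h2]

lemma blockCode_add_six (ε : ℕ → ℕ) (n : ℕ) :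
    blockCode ε (3 * n + 6) = if ε n = 1 then 0 else 2 := by
  have h1 : (3 * n + 6) % 3 = 0 := by omega
  have h2 : (3 * n + 6) / 3 - 2 = n := by omega
  simp [blockCode, h1, h2]

lemma blockCode_congr {ε ε' : ℕ → ℕ} {n : ℕ} (h : ∀ i < n, ε i = ε' i) {j : ℕ}
    (hj : j < 3 * n + 5) : blockCode ε j = blockCode ε' j := by
  unfold blockCode
  split_ifs with h1 h2 h3 h4 h5 h6 h7 h8 h9 h10 h11 <;> first | rfl | skip
  all_goals
    first
    | rw [h (j / 3 - 1) (by omega)] at *; omega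
    | rw [h (j / 3 - 2) (by omega)] at *; omega

lemma isBlockCode_blockCode (ε : ℕ → ℕ) : IsBlockCode (blockCode ε) := by
  have hform : ∀ j, 0 < j → j < 4 ∨ ∃ n, j = 3 * n + 4 ∨ j = 3 * n + 5 ∨ j = 3 * n + 6 := by
    intro j _
    by_cases h : j < 4
    · exact Or.inl h
    · exact Or.inr ⟨(j - 4) / 3, by omega⟩
  have h4 := blockCode_add_four ε
  have h5 := blockCode_add_five ε
  have h6 := blockCode_add_six ε
  have c0 : blockCode ε 0 = 3 := rfl
  have c1 : blockCode ε 1 = 1 := rfl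
  have c2 : blockCode ε 2 = 1 := rfl
  have c3 : blockCode ε 3 = 0 := rfl
  have c4 : blockCode ε 4 = 3 := rfl
  have c5 : blockCode ε 5 = if ε 0 = 1 then 1 else 0 := h5 0
  refine ⟨fun j => ?_, fun j => ?_, c0, c1, c2, fun j hj => ?_, fun j => ?_⟩
  · unfold blockCode
    split_ifs <;> omega
  · rw [IsTransition]
    rcases Nat.eq_zero_or_pos j with rfl | hj
    · rw [zero_add]; omega
    rcases hform j hj with h | ⟨n, rfl | rfl | rfl⟩
    · interval_cases j <;> simp only [Nat.reduceAdd] <;> omega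
    · have e5 := h5 n
      have e4 := h4 n
      rw [show 3 * n + 4 + 1 = 3 * n + 5 by ring]
      split_ifs at e5 <;> omega
    · have e5 := h5 n
      have e6 := h6 n
      rw [show 3 * n + 5 + 1 = 3 * n + 6 by ring]
      split_ifs at e5 e6 <;> omega
    · have e6 := h6 n
      have e4 := h4 (n + 1)
      rw [show 3 * n + 6 + 1 = 3 * (n + 1) + 4 by ring]
      split_ifs at e6 <;> omega
  · rcases hform j hj with h | ⟨n, rfl | rfl | rfl⟩
    · interval_cases j <;> simp only [Nat.reduceAdd] <;> omega
    · have e5 := h5 n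
      have e6 := h6 n
      rw [show 3 * n + 4 + 1 = 3 * n + 5 by ring, show 3 * n + 4 + 2 = 3 * n + 6 by ring]
      split_ifs at e5 e6 <;> omega
    · have e5 := h5 n
      split_ifs at e5 <;> omega
    · have e6 := h6 n
      split_ifs at e6 <;> omega
  · rcases Nat.eq_zero_or_pos j with rfl | hj
    · rw [zero_add]; omega
    rcases hform j hj with h | ⟨n, rfl | rfl | rfl⟩
    · interval_cases j <;> simp only [Nat.reduceAdd] <;> omega
    · have e4 := h4 n
      omega
    · have e4 := h4 (n + 1)
      intro _ _
      rwa [show 3 * n + 5 + 2 = 3 * (n + 1) + 4 by ring]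
    · have e4 := h4 (n + 1)
      rw [show 3 * n + 6 + 1 = 3 * (n + 1) + 4 by ring]
      omega

end Blocks

/-- The image of the unit interval under a map that shrinks distances at most polynomially has
positive Hausdorff dimension. -/
lemma dimH_image_Icc_pos {f : ℝ → ℝ} {c : ℝ} (hc : 0 < c) {L : ℕ} (hL : 0 < L)
    (h : ∀ s ∈ Icc (0 : ℝ) 1, ∀ t ∈ Icc (0 : ℝ) 1, c * |s - t| ^ L ≤ |f s - f t|) :
    0 < dimH (f '' Icc 0 1) := by
  have hinj : InjOn f (Icc 0 1) := by
    intro s hs t ht hst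
    have h1 := h s hs t ht
    rw [hst, sub_self, abs_zero] at h1
    have h2 : |s - t| ^ L = 0 :=
      le_antisymm (nonpos_of_mul_nonpos_right h1 hc) (by positivity)
    exact sub_eq_zero.1 (abs_eq_zero.1 (pow_eq_zero_iff hL.ne' |>.1 h2))
  let g := Function.invFunOn f (Icc 0 1)
  have hg : ∀ t ∈ Icc (0 : ℝ) 1, g (f t) = t := fun t ht => hinj.leftInvOn_invFunOn ht
  have hr : (0 : NNReal) < (L : NNReal)⁻¹ := by positivity
  have hholder : HolderOnWith (Real.toNNReal (c⁻¹ ^ (L : ℝ)⁻¹)) (L : NNReal)⁻¹ g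
      (f '' Icc 0 1) := by
    rintro _ ⟨s, hs, rfl⟩ _ ⟨t, ht, rfl⟩
    rw [hg s hs, hg t ht, edist_dist, edist_dist, Real.dist_eq, Real.dist_eq,
      ENNReal.ofReal_rpow_of_nonneg (abs_nonneg _) (by positivity)]
    change _ ≤ ENNReal.ofReal _ * _
    rw [← ENNReal.ofReal_mul (by positivity)]
    refine ENNReal.ofReal_le_ofReal ?_
    push_cast
    rw [← Real.mul_rpow (by positivity) (by positivity)]
    calc |s - t| = (|s - t| ^ L) ^ (L : ℝ)⁻¹ :=
          (Real.pow_rpow_inv_natCast (abs_nonneg _) hL.ne').symm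
      _ ≤ (c⁻¹ * |f s - f t|) ^ (L : ℝ)⁻¹ := by
          refine Real.rpow_le_rpow (by positivity) ?_ (by positivity)
          rw [inv_mul_eq_div, le_div_iff₀' hc]
          exact h s hs t ht
  have himage : g '' (f '' Icc 0 1) = Icc 0 1 := by
    rw [← image_comp]
    exact (image_congr hg).trans (image_id' _)
  have hdim := hholder.dimH_image_le hr
  have hone : dimH (Icc (0 : ℝ) 1) = 1 := by
    rw [Real.dimH_of_nonempty_interior (by simp [interior_Icc])]
    simp
  rw [himage, hone] at hdim
  refine pos_iff_ne_zero.2 fun h0 => ?_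
  rw [h0, ENNReal.zero_div] at hdim
  exact absurd hdim (by simp)

section Construction

variable {M m : ℕ} {α : ℕ → ℕ} {p q : ℝ}

lemma abs_piQ_sub_le {d e : ℕ → ℕ} (hq : 1 < q) (hd : ∀ i, d i ≤ M) (he : ∀ i, e i ≤ M) {n : ℕ}
    (h : ∀ i < n, d i = e i) : |piQ q d - piQ q e| ≤ M / (q - 1) / q ^ n := by
  have hq0 : (0 : ℝ) < q ^ n := by positivity
  rw [piQ_sub_of_agree hq hd he h, abs_div, abs_of_pos hq0]
  gcongr
  exact abs_sub_le_of_nonneg_of_le (piQ_nonneg hq _) (piQ_le hq (tailSeq_le hd n))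
    (piQ_nonneg hq _) (piQ_le hq (tailSeq_le he n))

lemma piQ_lt_piQ {d : ℕ → ℕ} {q' : ℝ} (hq : 1 < q) (hqq' : q < q') (hd : ∀ i, d i ≤ M)
    (h0 : 0 < d 0) : piQ q' d < piQ q d := by
  have hq0 : 0 < q := by linarith
  refine Summable.tsum_lt_tsum (i := 0) (fun i => ?_) ?_ (summable_piQ (hq.trans hqq') hd)
    (summable_piQ hq hd)
  · gcongr
  · have : (0 : ℝ) < d 0 := by exact_mod_cast h0
    simp only [zero_add, pow_one]
    gcongr

lemma continuousOn_piQ {a : ℝ} (ha : 1 < a) {d : ℕ → ℕ} (hd : ∀ i, d i ≤ M) :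
    ContinuousOn (fun q => piQ q d) (Ici a) := by
  obtain ⟨C, hC, h⟩ := exists_lipschitz_piQ M ha
  refine (LipschitzOnWith.of_dist_le_mul (K := C.toNNReal) fun x hx y hy => ?_).continuousOn
  rw [Real.dist_eq, Real.dist_eq, Real.coe_toNNReal _ hC.le]
  exact h d hd x y hx hy

/-- Sequences sharing a long prefix with an expansion of `1` in base `p` are expansions of `1` in
bases close to `p`. -/
lemma exists_base_near {η : ℝ} (hη : 0 < η) (hp : 1 < p - η) (hα : IsExpansion M p 1 α)
    (h0 : 0 < α 0) : ∃ N, ∀ β : ℕ → ℕ, (∀ i, β i ≤ M) → (∀ i < N, β i = α i) →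
      ∃ q ∈ Icc (p - η) (p + η), piQ q β = 1 := by
  have hsmall : ∀ q : ℝ, 1 < q → ∀ g : ℝ, 0 < g → ∀ᶠ n : ℕ in atTop,
      (M : ℝ) / (q - 1) / q ^ n < g := by
    intro q hq g hg
    have h1 : Tendsto (fun n : ℕ => (M / (q - 1)) * (q⁻¹) ^ n) atTop (nhds 0) := by
      simpa using (tendsto_pow_atTop_nhds_zero_of_lt_one (inv_nonneg.2 (by linarith))
        (inv_lt_one_of_one_lt₀ hq)).const_mul ((M : ℝ) / (q - 1))
    filter_upwards [h1.eventually_lt_const hg] with n hn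
    rwa [inv_pow, ← div_eq_mul_inv] at hn
  have hlow := piQ_lt_piQ hp (by linarith : p - η < p) hα.1 h0
  have hhigh := piQ_lt_piQ (by linarith : 1 < p) (by linarith : p < p + η) hα.1 h0
  rw [hα.2] at hlow hhigh
  obtain ⟨N, hN₁, hN₂⟩ := ((hsmall (p - η) hp _ (sub_pos.2 hlow)).and
    (hsmall (p + η) (by linarith) _ (sub_pos.2 hhigh))).exists
  refine ⟨N, fun β hβ hagree => ?_⟩
  have h1 := (abs_le.1 (abs_piQ_sub_le hp hβ hα.1 hagree)).1
  have h2 := (abs_le.1 (abs_piQ_sub_le (by linarith : 1 < p + η) hβ hα.1 hagree)).2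
  have hcont := (continuousOn_piQ hp hβ).mono (Icc_subset_Ici_self : Icc (p - η) (p + η) ⊆ _)
  have hmem : (1 : ℝ) ∈ Icc (piQ (p + η) β) (piQ (p - η) β) := ⟨by linarith, by linarith⟩
  obtain ⟨q, hq, hqβ⟩ := intermediate_value_Icc' (by linarith) hcont hmem
  exact ⟨q, hq, hqβ⟩

/-- The strictly admissible sequence coding the binary sequence `ε`. -/
def codeSeq (M m : ℕ) (α ε : ℕ → ℕ) : ℕ → ℕ := blockSeq M m α (blockCode ε)

/-- If `ε` and `ε'` first differ at `n`, the bases represented by their codes are separated by an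
exponentially small amount. -/
lemma le_abs_sub_base (hgood : IsGoodLength M α m) (hα : ∀ i, α i ≤ M)
    (hle : ∀ n, ¬ seqLt α (tailSeq n α)) (hm : 2 ≤ m) {C : ℝ} {a : ℝ} (ha : 1 < a)
    (hC : ∀ d : ℕ → ℕ, (∀ i, d i ≤ M) → ∀ q q' : ℝ, a ≤ q → a ≤ q' →
      |piQ q d - piQ q' d| ≤ C * |q - q'|)
    {ε ε' : ℕ → ℕ} {n : ℕ} (hεε' : ∀ i < n, ε i = ε' i) (hn : ε n ≠ 1) (hn' : ε' n = 1)
    {q' : ℝ} (hq : a ≤ q) (hq' : a ≤ q') (h : piQ q (codeSeq M m α ε) = 1)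
    (h' : piQ q' (codeSeq M m α ε') = 1) :
    (((M : ℝ) + 1) ^ (7 * m + 1 + 3 * m * n))⁻¹ ≤ C * |q - q'| := by
  have hq1 : 1 < q := by linarith
  have hadm := isStrictlyAdmissible_blockSeq hgood hα hle hm (isBlockCode_blockCode ε)
  have hadm' := isStrictlyAdmissible_blockSeq hgood hα hle hm (isBlockCode_blockCode ε')
  change IsStrictlyAdmissible M (codeSeq M m α ε) at hadm
  change IsStrictlyAdmissible M (codeSeq M m α ε') at hadm'
  have hlast := hgood.lt_last (by omega)
  have hhead := head_ge hle (m - 1)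
  have hαm := hα (m - 1)
  have hα0 := hα 0
  have hm1 : m - 1 + 1 = m := by omega
  set N := m * (3 * n + 5) + (m - 1) with hN
  have hagree : ∀ i < N, codeSeq M m α ε' i = codeSeq M m α ε i := by
    intro i hi
    rcases lt_or_ge i (m * (3 * n + 5)) with h1 | h1
    · simp only [codeSeq, blockSeq]
      rw [blockCode_congr hεε' (Nat.div_lt_of_lt_mul h1)]
    · obtain ⟨s, rfl⟩ := Nat.exists_eq_add_of_le h1
      have h2 : ¬ s + 1 = m := by omega
      rw [codeSeq, codeSeq, blockSeq_add _ (by omega), blockSeq_add _ (by omega),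
        blockCode_add_five, blockCode_add_five, if_pos hn', if_neg hn]
      simp [blockDigit, h2]
  have hdigit : codeSeq M m α ε' N = codeSeq M m α ε N + 1 := by
    rw [codeSeq, codeSeq, blockSeq_add _ (by omega), blockSeq_add _ (by omega),
      blockCode_add_five, blockCode_add_five, if_pos hn', if_neg hn]
    simp only [blockDigit, hm1]
    simp only [if_true, if_neg (by decide : ¬ (1 : ℕ) = 3), if_neg (by decide : ¬ (1 : ℕ) = 2),
      if_neg (by decide : ¬ (0 : ℕ) = 3), if_neg (by decide : ¬ (0 : ℕ) = 2),
      if_neg (by decide : ¬ (0 : ℕ) = 1)]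
    omega
  have htail : 1 / q ^ (m + 1) ≤ piQ q (tailSeq (N + 1) (codeSeq M m α ε')) := by
    refine le_trans ?_ (le_piQ hq1 (tailSeq_le hadm'.le _) m)
    have h1 : m + (N + 1) = m * (3 * (n + 1) + 4) + 0 := by
      rw [hN, add_assoc, hm1]
      ring
    rw [tailSeq, h1, codeSeq, blockSeq_add _ (by omega), blockCode_add_four]
    have h2 : blockDigit M m α 3 0 = α 0 := by simp [blockDigit]
    have h3 : (1 : ℝ) ≤ α 0 := by exact_mod_cast (by omega : 1 ≤ α 0)
    rw [h2]
    gcongr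
  have hdiff := piQ_sub_of_agree_succ hq1 hadm'.le hadm.le hagree
  have hcast : (codeSeq M m α ε' N : ℝ) = codeSeq M m α ε N + 1 := by exact_mod_cast hdigit
  have hle1 := (hadm.piQ_le_one hq1 h (N + 1)).1
  have hqM : q ≤ M + 1 := le_of_piQ_eq_one hq1 hadm.le h
  have hexp : 7 * m + 1 + 3 * m * n = (m + 1) + (N + 1) := by
    rw [hN, add_assoc _ (m - 1), hm1]
    ring
  calc (((M : ℝ) + 1) ^ (7 * m + 1 + 3 * m * n))⁻¹
      ≤ (q ^ (7 * m + 1 + 3 * m * n))⁻¹ := by gcongr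
    _ = 1 / q ^ (m + 1) / q ^ (N + 1) := by
        rw [hexp, pow_add, div_div, one_div]
    _ ≤ piQ q (codeSeq M m α ε') - piQ q (codeSeq M m α ε) := by
        rw [hdiff]
        gcongr
        linarith
    _ = piQ q (codeSeq M m α ε') - piQ q' (codeSeq M m α ε') := by rw [h, h']
    _ ≤ |piQ q (codeSeq M m α ε') - piQ q' (codeSeq M m α ε')| := le_abs_self _
    _ ≤ C * |q - q'| := hC _ hadm'.le _ _ hq hq'

/-- Near every univoque base, the univoque bases form a set of positive Hausdorff dimension. -/
lemma dimH_univBases_inter_pos (hM : 0 < M) (hp : p ∈ UnivBases M) {η : ℝ} (hη : 0 < η)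
    (hη1 : 1 < p - η) : 0 < dimH (UnivBases M ∩ Icc (p - η) (p + η)) := by
  obtain ⟨hp1, hpM, α, hα, huniq⟩ := hp
  have hα0 := head_pos_of_unique hM hp1 hpM hα huniq
  have hle := not_seqLt_tailSeq_of_unique hp1 hpM hα huniq
  have hrefl : ∀ n, seqLt (reflSeq M (tailSeq n α)) α := by
    intro n
    rcases n with _ | n
    · exact ⟨0, fun i hi => absurd hi (Nat.not_lt_zero i),
        reflSeq_head_lt_of_unique hM hp1 hpM hα huniq⟩
    · exact seqLt_reflSeq_of_unique hM hp1 hpM hα huniq n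
  obtain ⟨N, hN⟩ := exists_base_near hη hη1 hα hα0
  obtain ⟨m, hm, hgood⟩ := exists_isGoodLength hle hrefl (max N 2)
  have hm2 : 2 ≤ m := (le_max_right _ _).trans hm
  have hadm : ∀ ε, IsStrictlyAdmissible M (codeSeq M m α ε) := fun ε =>
    isStrictlyAdmissible_blockSeq hgood hα.1 hle hm2 (isBlockCode_blockCode ε)
  have hbase : ∀ ε, ∃ q ∈ Icc (p - η) (p + η), piQ q (codeSeq M m α ε) = 1 := fun ε =>
    hN _ (hadm ε).le fun i hi =>
      blockSeq_prefix rfl (hi.trans_le ((le_max_left _ _).trans hm))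
  choose base hbaseI hbase using hbase
  have hbin : ∀ t : ℝ, ∃ ε : ℕ → ℕ, t ∈ Icc (0 : ℝ) 1 → IsExpansion 1 2 t ε := by
    intro t
    by_cases ht : t ∈ Icc (0 : ℝ) 1
    · obtain ⟨ε, hε⟩ := exists_isExpansion (M := 1) (q := 2) (y := t) (by norm_num) (by norm_num)
        (by norm_num; exact ht)
      exact ⟨ε, fun _ => hε⟩
    · exact ⟨fun _ => 0, fun h => absurd h ht⟩
  choose digits hdigits using hbin
  obtain ⟨C, hC, hlip⟩ := exists_lipschitz_piQ M hη1
  have hsub : (fun t => base (digits t)) '' Icc 0 1 ⊆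
      UnivBases M ∩ Icc (p - η) (p + η) := by
    rintro _ ⟨t, -, rfl⟩
    exact ⟨(hadm _).mem_univBases (hη1.trans_le (hbaseI _).1) (hbase _), hbaseI _⟩
  refine lt_of_lt_of_le ?_ (dimH_mono hsub)
  refine dimH_image_Icc_pos (c := (C * ((M : ℝ) + 1) ^ (7 * m + 1))⁻¹) (L := 3 * m * M)
    (by positivity) (by positivity) fun s hs t ht => ?_
  by_cases hst : digits s = digits t
  · have : s = t := by rw [← (hdigits s hs).2, ← (hdigits t ht).2, hst]
    have hL : 3 * m * M ≠ 0 := by positivity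
    simp [this, hL]
  obtain ⟨n, hn, hne⟩ := exists_first_ne hst
  have hsep : (((M : ℝ) + 1) ^ (7 * m + 1 + 3 * m * n))⁻¹ ≤
      C * |base (digits s) - base (digits t)| := by
    have h1 := (hdigits s hs).1 n
    have h2 := (hdigits t ht).1 n
    by_cases h3 : digits t n = 1
    · exact le_abs_sub_base hgood hα.1 hle hm2 hη1 hlip hn (by omega) h3 (hbaseI _).1 (hbaseI _).1
        (hbase _) (hbase _)
    · rw [abs_sub_comm]
      exact le_abs_sub_base hgood hα.1 hle hm2 hη1 hlip (fun i hi => (hn i hi).symm) h3 (by omega)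
        (hbaseI _).1 (hbaseI _).1 (hbase _) (hbase _)
  have hclose : |s - t| ≤ ((2 : ℝ) ^ n)⁻¹ := by
    have := abs_piQ_sub_le (q := 2) (by norm_num) (hdigits s hs).1 (hdigits t ht).1 hn
    rw [(hdigits s hs).2, (hdigits t ht).2] at this
    norm_num at this
    exact this
  have htwo : ((M : ℝ) + 1) ≤ 2 ^ M := by exact_mod_cast Nat.lt_two_pow_self (n := M)
  have hpow : |s - t| ^ (3 * m * M) ≤ (((M : ℝ) + 1) ^ (3 * m * n))⁻¹ := by
    calc |s - t| ^ (3 * m * M) ≤ (((2 : ℝ) ^ n)⁻¹) ^ (3 * m * M) := by gcongr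
      _ = (((2 : ℝ) ^ M) ^ (3 * m * n))⁻¹ := by
          rw [inv_pow, ← pow_mul, ← pow_mul]
          congr 2
          ring
      _ ≤ _ := by gcongr
  calc (C * ((M : ℝ) + 1) ^ (7 * m + 1))⁻¹ * |s - t| ^ (3 * m * M)
      ≤ (C * ((M : ℝ) + 1) ^ (7 * m + 1))⁻¹ * (((M : ℝ) + 1) ^ (3 * m * n))⁻¹ := by gcongr
    _ = C⁻¹ * (((M : ℝ) + 1) ^ (7 * m + 1 + 3 * m * n))⁻¹ := by
        rw [pow_add _ (7 * m + 1) (3 * m * n), mul_inv, mul_inv, mul_assoc]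
    _ ≤ C⁻¹ * (C * |base (digits s) - base (digits t)|) := by gcongr
    _ = |base (digits s) - base (digits t)| := inv_mul_cancel_left₀ hC.ne' _

end Construction

/-- For every `δ > 0`, the Hausdorff dimension of `B₂ ∩ (q', q' + δ)` is
strictly positive. -/
theorem stmt8 (M : ℕ) (hM : 0 < M) :
    ∀ δ : ℝ, 0 < δ → 0 < dimH (B2 M ∩ Ioo (KL M) (KL M + δ)) := by
  intro δ hδ
  obtain ⟨p, hp, hpδ⟩ := exists_lt_of_csInf_lt (univBases_nonempty hM)
    (by simpa using hδ : KL M < KL M + δ)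
  have hp1 := hp.1
  obtain ⟨η, hη, hη'⟩ := exists_between (lt_min (sub_pos.2 hp1) (sub_pos.2 hpδ))
  rw [lt_min_iff] at hη'
  have hpos := dimH_univBases_inter_pos hM hp hη (by linarith)
  have hbdd : BddBelow (UnivBases M) := ⟨1, fun q hq => hq.1.le⟩
  have hsub : UnivBases M ∩ Icc (p - η) (p + η) ⊆
      (B2 M ∩ Ioo (KL M) (KL M + δ)) ∪ {KL M} := by
    rintro q ⟨hqU, -, hq⟩
    rcases (csInf_le hbdd hqU : KL M ≤ q).lt_or_eq with h | h
    · exact Or.inl ⟨univBases_subset_B2 hM hqU, h, by linarith⟩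
    · exact Or.inr h.symm
  have hle := dimH_mono hsub
  rw [dimH_union, dimH_singleton, max_eq_left zero_le] at hle
  exact hpos.trans_le hle

end
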